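/- Let d ≥ 1, let E = {E_i}_{i=1}^{d²} be an unbiased MIC (tr E_i = 1/d for all i) for d×d complex matrices, and let F = {F_i}_{i=1}^{d²} be an unbiased Wigner basis. Let ‖X‖² = tr(X²) denote the squared Hilbert–Schmidt norm. Then ((d−1)/d)·(d + 2 − 2√(d+1)) ≤ Σ_i ‖E_i − F_i‖² ≤ ((d−1)/d)·(d + 2 + 2√(d+1)), where the lower bound is attained if and only if E is a SIC and F is its principal Wigner basis, and the upper bound is attained if and only if E is a SIC and F is its shifted principal Wigner basis. -/

import Mathlib

open Matrix BigOperators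
open scoped ComplexOrder Kronecker

/-- A measure basis: a linearly independent family of `d²` Hermitian `d×d` complex
matrices summing to the identity, with nonnegative traces. -/
def IsMeasureBasis {d : ℕ} (L : Fin (d ^ 2) → Matrix (Fin d) (Fin d) ℂ) : Prop :=
  (∀ i, (L i).IsHermitian) ∧ LinearIndependent ℝ L ∧ (∑ i, L i) = 1 ∧ ∀ i, 0 ≤ ((L i).trace).re

/-- A Wigner basis: an orthogonal measure basis. -/
def IsWignerBasis {d : ℕ} (L : Fin (d ^ 2) → Matrix (Fin d) (Fin d) ℂ) : Prop :=
  IsMeasureBasis L ∧ ∀ i j, i ≠ j → (L i * L j).trace = 0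

/-- The rescaled frame operator `S_L(X) = ∑ⱼ (tr(X Lⱼ)/lⱼ) Lⱼ`. -/
noncomputable def rsFrameOp {n : Type*} [Fintype n] {m : Type*} [Fintype m] [DecidableEq m]
    (L : n → Matrix m m ℂ) (X : Matrix m m ℂ) : Matrix m m ℂ :=
  ∑ j, (((X * L j).trace) / ((L j).trace)) • L j

/-- A map on matrices that is ℝ-linear, Hermiticity-preserving, self-adjoint with respect to
the Hilbert–Schmidt inner product on Hermitian matrices, and positive. -/
def IsPosSelfAdjMap {m : Type*} [Fintype m]
    (T : Matrix m m ℂ → Matrix m m ℂ) : Prop :=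
  IsLinearMap ℝ T ∧ (∀ X, X.IsHermitian → (T X).IsHermitian) ∧
  (∀ X Y, X.IsHermitian → Y.IsHermitian → (T X * Y).trace = (X * T Y).trace) ∧
  (∀ X, X.IsHermitian → 0 ≤ ((X * T X).trace).re)

/-- `T` is the (unique) positive self-adjoint inverse square root of the rescaled frame
operator of `L`, i.e. `S_L ∘ T ∘ T = id` on Hermitian matrices; `PW(L) i = T (L i)`. -/
def IsInvSqrtOfFrameOp {n : Type*} [Fintype n] {m : Type*} [Fintype m] [DecidableEq m]
    (L : n → Matrix m m ℂ) (T : Matrix m m ℂ → Matrix m m ℂ) : Prop :=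
  IsPosSelfAdjMap T ∧ ∀ X : Matrix m m ℂ, X.IsHermitian → rsFrameOp L (T (T X)) = X

/-- The real Hilbert–Schmidt pairing. -/
noncomputable def hs {d : ℕ} (X Y : Matrix (Fin d) (Fin d) ℂ) : ℝ := ((X * Y).trace).re

section hsLemmas
variable {d : ℕ} (X Y Z : Matrix (Fin d) (Fin d) ℂ) (r : ℝ)

lemma hs_add_left : hs (X + Y) Z = hs X Z + hs Y Z := by simp [hs, add_mul]
lemma hs_add_right : hs X (Y + Z) = hs X Y + hs X Z := by simp [hs, mul_add]
lemma hs_sub_left : hs (X - Y) Z = hs X Z - hs Y Z := by simp [hs, sub_mul]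
lemma hs_sub_right : hs X (Y - Z) = hs X Y - hs X Z := by simp [hs, mul_sub]
lemma hs_smul_left : hs (r • X) Y = r * hs X Y := by simp [hs]
lemma hs_smul_right : hs X (r • Y) = r * hs X Y := by simp [hs]
lemma hs_comm : hs X Y = hs Y X := by simp [hs, trace_mul_comm X Y]
lemma hs_one_one : hs (1 : Matrix (Fin d) (Fin d) ℂ) 1 = d := by simp [hs]
lemma hs_sum_left {ι : Type*} (s : Finset ι) (f : ι → Matrix (Fin d) (Fin d) ℂ) :
    hs (∑ i ∈ s, f i) Z = ∑ i ∈ s, hs (f i) Z := by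
  simp [hs, Finset.sum_mul, trace_sum]
lemma hs_sum_right {ι : Type*} (s : Finset ι) (f : ι → Matrix (Fin d) (Fin d) ℂ) :
    hs Z (∑ i ∈ s, f i) = ∑ i ∈ s, hs Z (f i) := by
  simp [hs, Finset.mul_sum, trace_sum]

variable {X Y}
lemma trace_eq_hs (hX : X.IsHermitian) (hY : Y.IsHermitian) :
    (X * Y).trace = (hs X Y : ℂ) := by
  have h : star ((X * Y).trace) = (X * Y).trace := by
    rw [← trace_conjTranspose, conjTranspose_mul, hX.eq, hY.eq, trace_mul_comm]
  exact (Complex.conj_eq_iff_re.1 h).symm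

lemma hs_self (hX : X.IsHermitian) : 0 ≤ hs X X ∧ (hs X X = 0 → X = 0) := by
  have h : 0 ≤ (Xᴴ * X).trace := (posSemidef_conjTranspose_mul_self X).trace_nonneg
  rw [hX.eq] at h
  refine ⟨(Complex.nonneg_iff.1 h).1, fun h0 => ?_⟩
  have : (Xᴴ * X).trace = 0 := by
    rw [hX.eq, trace_eq_hs hX hX, h0]; simp
  exact trace_conjTranspose_mul_self_eq_zero_iff.1 this

lemma hs_self_le (hX : X.PosSemidef) : hs X X ≤ (X.trace.re) ^ 2 := by
  have h1 : X.trace.re = ∑ i, hX.1.eigenvalues i := by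
    rw [hX.1.trace_eq_sum_eigenvalues]; simp
  have h2 : hs X X = ∑ i, (hX.1.eigenvalues i) ^ 2 := by
    unfold hs
    conv_lhs => rw [hX.1.spectral_theorem, ← map_mul, Unitary.conjStarAlgAut_apply,
      trace_mul_cycle, Unitary.coe_star_mul_self, one_mul, diagonal_mul_diagonal]
    simp [trace_diagonal, sq]
  rw [h1, h2]
  exact Finset.sum_sq_le_sq_sum_of_nonneg fun i _ => hX.eigenvalues_nonneg i
end hsLemmas

section main
variable {d : ℕ} [NeZero d]

lemma herm_smul {X : Matrix (Fin d) (Fin d) ℂ} (hX : X.IsHermitian) (r : ℝ) :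
    (r • X).IsHermitian := by
  simp [Matrix.IsHermitian, conjTranspose_smul, hX.eq]

/-- uniqueness of the square root on eigenvectors -/
lemma T_eigen {T : Matrix (Fin d) (Fin d) ℂ → Matrix (Fin d) (Fin d) ℂ} (hT : IsPosSelfAdjMap T)
    {X : Matrix (Fin d) (Fin d) ℂ} (hX : X.IsHermitian) {s : ℝ} (hs0 : 0 < s)
    (h : T (T X) = (s ^ 2) • X) : T X = s • X := by
  obtain ⟨hl, hh, -, hp⟩ := hT
  have hY : (T X - s • X).IsHermitian := (hh X hX).sub (herm_smul hX s)
  have hTY : T (T X - s • X) = (-s) • (T X - s • X) := by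
    rw [hl.map_sub, hl.map_smul, h]; module
  have h1 := hp _ hY
  change 0 ≤ hs _ _ at h1
  rw [hTY, hs_smul_right] at h1
  have h2 := hs_self hY
  exact sub_eq_zero.1 (h2.2 (by nlinarith [h2.1]))

variable {E : Fin (d ^ 2) → Matrix (Fin d) (Fin d) ℂ}

lemma frame_eq (hH : ∀ i, (E i).IsHermitian) (hEunb : ∀ i, (E i).trace = ((d : ℂ))⁻¹)
    {X : Matrix (Fin d) (Fin d) ℂ} (hX : X.IsHermitian) :
    rsFrameOp E X = ∑ j, ((d : ℝ) * hs X (E j)) • E j := by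
  unfold rsFrameOp
  refine Finset.sum_congr rfl fun j _ => ?_
  rw [hEunb, trace_eq_hs hX (hH j), div_inv_eq_mul, mul_comm]
  ext a b
  simp

lemma frame_inj {T : Matrix (Fin d) (Fin d) ℂ → Matrix (Fin d) (Fin d) ℂ}
    (hH : ∀ i, (E i).IsHermitian) (hEunb : ∀ i, (E i).trace = ((d : ℂ))⁻¹)
    (hT : IsInvSqrtOfFrameOp E T)
    {X : Matrix (Fin d) (Fin d) ℂ} (hX : X.IsHermitian) (h0 : rsFrameOp E X = 0) : X = 0 := by
  have hd : (0 : ℝ) < d := by exact_mod_cast Nat.pos_of_ne_zero (NeZero.ne d)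
  have h1 : ∑ j, (d : ℝ) * (hs X (E j) * hs X (E j)) = 0 := by
    have : hs X (rsFrameOp E X) = 0 := by rw [h0]; simp [hs]
    rw [frame_eq hH hEunb hX, hs_sum_right] at this
    rw [← this]
    refine Finset.sum_congr rfl fun j _ => ?_
    rw [hs_smul_right]; ring
  have h2 : ∀ j, hs X (E j) = 0 := by
    intro j
    rw [Finset.sum_eq_zero_iff_of_nonneg (fun i _ => by positivity [mul_self_nonneg (hs X (E i))])] at h1
    have := h1 j (Finset.mem_univ _)
    simpa [hd.ne'] using this
  have h3 := hT.2 X hX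
  have hTT := hT.1.2.1 _ (hT.1.2.1 X hX)
  rw [frame_eq hH hEunb hTT] at h3
  apply (hs_self hX).2
  calc hs X X = hs X (∑ j, ((d : ℝ) * hs (T (T X)) (E j)) • E j) := by rw [h3]
    _ = 0 := by
      rw [hs_sum_right]
      exact Finset.sum_eq_zero fun j _ => by rw [hs_smul_right, h2, mul_zero]

lemma frame_T {T : Matrix (Fin d) (Fin d) ℂ → Matrix (Fin d) (Fin d) ℂ}
    (hH : ∀ i, (E i).IsHermitian) (hEunb : ∀ i, (E i).trace = ((d : ℂ))⁻¹)
    (hT : IsInvSqrtOfFrameOp E T)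
    {X : Matrix (Fin d) (Fin d) ℂ} (hX : X.IsHermitian) {s : ℝ} (hs0 : 0 < s)
    (h : (s ^ 2) • rsFrameOp E X = X) : T X = s • X := by
  apply T_eigen hT.1 hX hs0
  have hTT := hT.1.2.1 _ (hT.1.2.1 X hX)
  have hY := hTT.sub (herm_smul hX (s ^ 2))
  refine sub_eq_zero.1 (frame_inj hH hEunb hT hY ?_)
  have h3 := hT.2 X hX
  rw [frame_eq hH hEunb hX] at h
  rw [frame_eq hH hEunb hTT] at h3
  rw [frame_eq hH hEunb hY]
  have : ∀ j, ((d : ℝ) * hs (T (T X) - s ^ 2 • X) (E j)) • E j =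
      ((d : ℝ) * hs (T (T X)) (E j)) • E j - (s ^ 2) • (((d : ℝ) * hs X (E j)) • E j) := by
    intro j
    rw [hs_sub_left, hs_smul_left]; module
  simp_rw [this]
  rw [Finset.sum_sub_distrib, ← Finset.smul_sum, h, h3, sub_self]

lemma T_form {T : Matrix (Fin d) (Fin d) ℂ → Matrix (Fin d) (Fin d) ℂ}
    (hE : IsMeasureBasis E) (hEunb : ∀ i, (E i).trace = ((d : ℂ))⁻¹)
    (hT : IsInvSqrtOfFrameOp E T)
    (hG : ∀ i j, hs (E i) (E j) =
      ((d : ℝ) ^ 2)⁻¹ * (((d : ℝ) * (if i = j then 1 else 0) + 1) / ((d : ℝ) + 1)))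
    (i : Fin (d ^ 2)) :
    T (E i) = (((d : ℝ) ^ 2)⁻¹) • (1 : Matrix (Fin d) (Fin d) ℂ) +
      Real.sqrt ((d : ℝ) + 1) • (E i - (((d : ℝ) ^ 2)⁻¹) • (1 : Matrix (Fin d) (Fin d) ℂ)) := by
  have hd : (0 : ℝ) < d := by exact_mod_cast Nat.pos_of_ne_zero (NeZero.ne d)
  obtain ⟨hH, -, hsum, -⟩ := hE
  have h1H : (1 : Matrix (Fin d) (Fin d) ℂ).IsHermitian := isHermitian_one
  have h1 : ∀ j, hs 1 (E j) = (d : ℝ)⁻¹ := by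
    intro j
    unfold hs
    rw [one_mul, hEunb, ← Complex.ofReal_natCast, ← Complex.ofReal_inv, Complex.ofReal_re]
  have hT1 : T 1 = 1 := by
    have := frame_T hH hEunb hT h1H (s := 1) one_pos (by
      rw [frame_eq hH hEunb h1H]
      simp [h1, hd.ne', hsum])
    simpa using this
  have hAH : (E i - (((d : ℝ) ^ 2)⁻¹) • (1 : Matrix (Fin d) (Fin d) ℂ)).IsHermitian :=
    (hH i).sub (herm_smul h1H _)
  have hTA := frame_T hH hEunb hT hAH (s := Real.sqrt ((d : ℝ) + 1)) (by positivity) (by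
    rw [frame_eq hH hEunb hAH, Real.sq_sqrt (by positivity)]
    have : ∀ j, ((d : ℝ) * hs (E i - (((d : ℝ) ^ 2)⁻¹) • (1 : Matrix (Fin d) (Fin d) ℂ)) (E j)) • E j
        = (if i = j then ((d : ℝ) + 1)⁻¹ • E j else 0)
          - (((d : ℝ) ^ 2)⁻¹ * ((d : ℝ) + 1)⁻¹) • E j := by
      intro j
      rw [hs_sub_left, hs_smul_left, h1, hG]
      split_ifs with h
      · rw [← sub_smul]; congr 1; field_simp; ring
      · rw [zero_sub, ← neg_smul]; congr 1; field_simp; ring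
    simp_rw [this]
    rw [Finset.sum_sub_distrib, ← Finset.smul_sum, hsum, Finset.sum_ite_eq]
    simp only [Finset.mem_univ, if_true]
    rw [smul_sub, smul_smul, smul_smul]
    congr 1
    · rw [mul_inv_cancel₀ (by positivity), one_smul]
    · congr 1; field_simp)
  have hl := hT.1.1
  calc T (E i) = T ((((d : ℝ) ^ 2)⁻¹) • (1 : Matrix (Fin d) (Fin d) ℂ) +
      (E i - (((d : ℝ) ^ 2)⁻¹) • (1 : Matrix (Fin d) (Fin d) ℂ))) := by congr 1; abel
    _ = _ := by rw [hl.map_add, hl.map_smul, hT1, hTA]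

end main

/-- for an unbiased MIC `E` and unbiased Wigner basis `F`,
`((d−1)/d)(d+2−2√(d+1)) ≤ ∑ᵢ‖Eᵢ − Fᵢ‖² ≤ ((d−1)/d)(d+2+2√(d+1))`, with the lower bound
attained iff `E` is a SIC and `F` its principal Wigner basis, and the upper bound attained
iff `E` is a SIC and `F` its shifted principal Wigner basis. -/
theorem sic_extremality {d : ℕ} [NeZero d]
    (E : Fin (d ^ 2) → Matrix (Fin d) (Fin d) ℂ)
    (hE : IsMeasureBasis E) (hEpsd : ∀ i, (E i).PosSemidef)
    (hEunb : ∀ i, (E i).trace = ((d : ℂ))⁻¹)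
    (F : Fin (d ^ 2) → Matrix (Fin d) (Fin d) ℂ)
    (hF : IsWignerBasis F) (hFunb : ∀ i, (F i).trace = ((d : ℂ))⁻¹)
    (T : Matrix (Fin d) (Fin d) ℂ → Matrix (Fin d) (Fin d) ℂ)
    (hT : IsInvSqrtOfFrameOp E T) :
    (((d : ℝ) - 1) / d * ((d : ℝ) + 2 - 2 * Real.sqrt ((d : ℝ) + 1)) ≤
        ∑ i, (((E i - F i) * (E i - F i)).trace).re) ∧
    (∑ i, (((E i - F i) * (E i - F i)).trace).re ≤
        ((d : ℝ) - 1) / d * ((d : ℝ) + 2 + 2 * Real.sqrt ((d : ℝ) + 1))) ∧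
    ((∑ i, (((E i - F i) * (E i - F i)).trace).re =
        ((d : ℝ) - 1) / d * ((d : ℝ) + 2 - 2 * Real.sqrt ((d : ℝ) + 1))) ↔
      ((∀ i j, (E i * E j).trace =
          ((((d : ℝ) ^ 2)⁻¹ * (((d : ℝ) * (if i = j then 1 else 0) + 1) / ((d : ℝ) + 1)) : ℝ) : ℂ)) ∧
        ∀ i, F i = T (E i))) ∧
    ((∑ i, (((E i - F i) * (E i - F i)).trace).re =
        ((d : ℝ) - 1) / d * ((d : ℝ) + 2 + 2 * Real.sqrt ((d : ℝ) + 1))) ↔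
      ((∀ i j, (E i * E j).trace =
          ((((d : ℝ) ^ 2)⁻¹ * (((d : ℝ) * (if i = j then 1 else 0) + 1) / ((d : ℝ) + 1)) : ℝ) : ℂ)) ∧
        ∀ i, F i = -(T (E i)) +
          ((2 * ((E i).trace).re / (d : ℝ)) • (1 : Matrix (Fin d) (Fin d) ℂ)))) := by
  have hd : (0 : ℝ) < d := by exact_mod_cast Nat.pos_of_ne_zero (NeZero.ne d)
  have hH := hE.1
  have hHF := hF.1.1
  have h1H : (1 : Matrix (Fin d) (Fin d) ℂ).IsHermitian := isHermitian_one
  have hE1 : ∀ j, hs 1 (E j) = (d : ℝ)⁻¹ := by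
    intro j
    unfold hs
    rw [one_mul, hEunb, ← Complex.ofReal_natCast, ← Complex.ofReal_inv, Complex.ofReal_re]
  have hF1 : ∀ j, hs 1 (F j) = (d : ℝ)⁻¹ := by
    intro j
    unfold hs
    rw [one_mul, hFunb, ← Complex.ofReal_natCast, ← Complex.ofReal_inv, Complex.ofReal_re]
  have hFG : ∀ i j, hs (F i) (F j) = if i = j then (d : ℝ)⁻¹ else 0 := by
    intro i j
    have hne : ∀ k l, k ≠ l → hs (F k) (F l) = 0 := by
      intro k l hkl
      simp [hs, hF.2 k l hkl]
    split_ifs with h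
    · subst h
      rw [← hF1 i, ← hF.1.2.2.1, hs_sum_left, Finset.sum_eq_single i]
      · intro b _ hb; exact hne _ _ hb
      · simp
    · exact hne _ _ h
  have htr : ∀ i, (E i).trace.re = (d : ℝ)⁻¹ := by
    intro i
    rw [hEunb, ← Complex.ofReal_natCast, ← Complex.ofReal_inv, Complex.ofReal_re]
  have he : ∀ i, hs (E i) (E i) ≤ ((d : ℝ) ^ 2)⁻¹ := by
    intro i
    have := hs_self_le (hEpsd i)
    rwa [htr, inv_pow] at this
  have hcard : ((Finset.univ : Finset (Fin (d ^ 2))).card : ℝ) = (d : ℝ) ^ 2 := by simp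
  set c : Matrix (Fin d) (Fin d) ℂ := (((d : ℝ) ^ 2)⁻¹) • (1 : Matrix (Fin d) (Fin d) ℂ) with hc
  have hcH : c.IsHermitian := herm_smul h1H _
  have hQH : ∀ (s : ℝ) i, (s • (E i - c) - (F i - c)).IsHermitian := fun s i =>
    (herm_smul ((hH i).sub hcH) s).sub ((hHF i).sub hcH)
  -- the key identity
  have key : ∀ s : ℝ, s ≠ 0 → s ^ 2 = (d : ℝ) + 1 →
      ∑ i, (((E i - F i) * (E i - F i)).trace).re =
        ((d : ℝ) - 1) / d * ((d : ℝ) + 2 - 2 * s) +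
        ∑ i, (hs (s • (E i - c) - (F i - c)) (s • (E i - c) - (F i - c)) / s +
          (s - 1) * (((d : ℝ) ^ 2)⁻¹ - hs (E i) (E i))) := by
    intro s hs0 hs2
    have hconst : ((d : ℝ) - 1) / d * ((d : ℝ) + 2 - 2 * s) =
        ∑ _i : Fin (d ^ 2), ((d : ℝ) - 1) / d ^ 3 * ((d : ℝ) + 2 - 2 * s) := by
      rw [Finset.sum_const, nsmul_eq_mul, hcard]; field_simp
    rw [hconst, ← Finset.sum_add_distrib]
    refine Finset.sum_congr rfl fun i _ => ?_
    change hs _ _ = _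
    rw [hc]
    simp only [hs_sub_left, hs_sub_right, hs_smul_left, hs_smul_right, hs_one_one, hE1, hF1,
      hs_comm (E i) 1, hs_comm (F i) 1, hs_comm (F i) (E i), hFG, if_true]
    generalize hs (E i) (E i) = e
    generalize hs (E i) (F i) = f
    have hd' : (d : ℝ) = s ^ 2 - 1 := by linarith
    have hd0 := hd.ne'
    rw [hd'] at hd0 ⊢
    field_simp
    ring
  have gram : ∀ s : ℝ, s ≠ 0 → s ^ 2 = (d : ℝ) + 1 →
      (∀ i, s • (E i - c) - (F i - c) = 0) →
      ∀ i j, hs (E i) (E j) =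
      ((d : ℝ) ^ 2)⁻¹ * (((d : ℝ) * (if i = j then 1 else 0) + 1) / ((d : ℝ) + 1)) := by
    intro s hs0 hs2 h i j
    have hEi : ∀ i, E i = c + s⁻¹ • (F i - c) := by
      intro i
      rw [← sub_eq_zero.1 (h i), smul_smul, inv_mul_cancel₀ hs0, one_smul]; abel
    rw [hEi i, hEi j, hc]
    simp only [hs_add_left, hs_add_right, hs_sub_left, hs_sub_right, hs_smul_left, hs_smul_right,
      hs_one_one, hF1, hs_comm (F i) 1, hFG]
    have hd' : (d : ℝ) = s ^ 2 - 1 := by linarith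
    have hd0 := hd.ne'
    rw [hd'] at hd0 ⊢
    split_ifs <;> field_simp <;> ring
  have gramC : (∀ i j, (E i * E j).trace =
      ((((d : ℝ) ^ 2)⁻¹ * (((d : ℝ) * (if i = j then 1 else 0) + 1) / ((d : ℝ) + 1)) : ℝ) : ℂ)) ↔
      ∀ i j, hs (E i) (E j) =
      ((d : ℝ) ^ 2)⁻¹ * (((d : ℝ) * (if i = j then 1 else 0) + 1) / ((d : ℝ) + 1)) := by
    refine forall_congr' fun i => forall_congr' fun j => ?_
    rw [trace_eq_hs (hH i) (hH j)]
    exact Complex.ofReal_inj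
  rw [gramC]
  have hdiag : (∀ i j, hs (E i) (E j) =
      ((d : ℝ) ^ 2)⁻¹ * (((d : ℝ) * (if i = j then 1 else 0) + 1) / ((d : ℝ) + 1))) →
      ∀ i, hs (E i) (E i) = ((d : ℝ) ^ 2)⁻¹ := by
    intro h i
    rw [h i i, if_pos rfl, mul_one, div_self (by positivity), mul_one]
  set s := Real.sqrt ((d : ℝ) + 1) with hsdef
  have hs2 : s ^ 2 = (d : ℝ) + 1 := Real.sq_sqrt (by positivity)
  have hspos : 0 < s := Real.sqrt_pos.2 (by positivity)
  have hs1 : 1 < s := by nlinarith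
  have kp := key s hspos.ne' hs2
  have km := key (-s) (neg_ne_zero.2 hspos.ne') (by rw [neg_sq]; exact hs2)
  have np : ∀ i ∈ (Finset.univ : Finset (Fin (d ^ 2))),
      0 ≤ hs (s • (E i - c) - (F i - c)) (s • (E i - c) - (F i - c)) / s +
          (s - 1) * (((d : ℝ) ^ 2)⁻¹ - hs (E i) (E i)) := fun i _ =>
    add_nonneg (div_nonneg (hs_self (hQH s i)).1 hspos.le)
      (mul_nonneg (by linarith) (by linarith [he i]))
  have nm : ∀ i ∈ (Finset.univ : Finset (Fin (d ^ 2))),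
      hs ((-s) • (E i - c) - (F i - c)) ((-s) • (E i - c) - (F i - c)) / (-s) +
          (-s - 1) * (((d : ℝ) ^ 2)⁻¹ - hs (E i) (E i)) ≤ 0 := fun i _ =>
    add_nonpos (div_nonpos_of_nonneg_of_nonpos (hs_self (hQH (-s) i)).1 (by linarith))
      (mul_nonpos_of_nonpos_of_nonneg (by linarith) (by linarith [he i]))
  have sp := Finset.sum_nonneg np
  have sm := Finset.sum_nonpos nm
  refine ⟨by rw [kp]; linarith, by rw [km]; linarith, ?_, ?_⟩
  · constructor
    · intro h
      have h0 := (Finset.sum_eq_zero_iff_of_nonneg np).1 (by linarith)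
      have hz : ∀ i, s • (E i - c) - (F i - c) = 0 := by
        intro i
        have h1 := h0 i (Finset.mem_univ i)
        have h2 : 0 ≤ (s - 1) * (((d : ℝ) ^ 2)⁻¹ - hs (E i) (E i)) :=
          mul_nonneg (by linarith) (by linarith [he i])
        have h3 := div_nonneg (hs_self (hQH s i)).1 hspos.le
        have h4 := (div_eq_zero_iff.1 (le_antisymm (by linarith) h3)).resolve_right hspos.ne'
        exact (hs_self (hQH s i)).2 h4
      have hG := gram s hspos.ne' hs2 hz
      refine ⟨hG, fun i => ?_⟩
      rw [T_form hE hEunb hT hG i, ← hc, ← hsdef, sub_eq_zero.1 (hz i)]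
      abel
    · rintro ⟨hG, hFT⟩
      rw [kp, Finset.sum_eq_zero, add_zero]
      intro i _
      have : s • (E i - c) - (F i - c) = 0 := by
        rw [hFT i, T_form hE hEunb hT hG i, ← hc, ← hsdef]
        abel
      rw [this, hdiag hG i]; simp [hs]
  · constructor
    · intro h
      have h0 := (Finset.sum_eq_zero_iff_of_nonpos nm).1 (by linarith)
      have hz : ∀ i, (-s) • (E i - c) - (F i - c) = 0 := by
        intro i
        have h1 := h0 i (Finset.mem_univ i)
        have h2 : (-s - 1) * (((d : ℝ) ^ 2)⁻¹ - hs (E i) (E i)) ≤ 0 :=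
          mul_nonpos_of_nonpos_of_nonneg (by linarith) (by linarith [he i])
        have h3 := div_nonpos_of_nonneg_of_nonpos (hs_self (hQH (-s) i)).1
          (show -s ≤ 0 by linarith)
        have h4 := (div_eq_zero_iff.1 (le_antisymm h3 (by linarith))).resolve_right
          (neg_ne_zero.2 hspos.ne')
        exact (hs_self (hQH (-s) i)).2 h4
      have hG := gram (-s) (neg_ne_zero.2 hspos.ne') (by rw [neg_sq]; exact hs2) hz
      refine ⟨hG, fun i => ?_⟩
      have h2c : ((2 * ((E i).trace).re / (d : ℝ)) • (1 : Matrix (Fin d) (Fin d) ℂ)) = c + c := by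
        rw [htr, hc, ← add_smul]; congr 1; field_simp; norm_num
      rw [T_form hE hEunb hT hG i, ← hc, ← hsdef, h2c]
      have h5 := sub_eq_zero.1 (hz i)
      rw [neg_smul] at h5
      rw [neg_add, h5]
      abel
    · rintro ⟨hG, hFT⟩
      rw [km, Finset.sum_eq_zero, add_zero]
      · ring
      intro i _
      have h2c : ((2 * ((E i).trace).re / (d : ℝ)) • (1 : Matrix (Fin d) (Fin d) ℂ)) = c + c := by
        rw [htr, hc, ← add_smul]; congr 1; field_simp; norm_num
      have : (-s) • (E i - c) - (F i - c) = 0 := by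
        rw [hFT i, T_form hE hEunb hT hG i, ← hc, ← hsdef, h2c, neg_smul]
        abel
      rw [this, hdiag hG i]; simp [hs]
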